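/- Assume q ≥ m. For any α ∈ Z^m and any i ∈ {1, ..., m}, ℓ(D_α) equals the number of equivalence classes of Γ̂_Q(α) under the relation ≡_i, where β ≡_i β' if and only if β_i = β'_i. -/

import Mathlib

open scoped Classical

/-- Abstract divisor-theoretic data of a nonsingular, projective, geometrically
irreducible algebraic curve over a field `Fq`: a function field `K`, a set of
closed points with their degrees, a genus, and the normalized discrete
valuations of `K` at the closed points (with the junk convention `v P 0 = 0`). -/
structure Curve (Fq : Type) [Field Fq] where
  /-- the function field of the curve -/
  K : Type
  [fieldK : Field K]
  [algebraK : Algebra Fq K]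
  /-- the closed points of the curve -/
  Point : Type
  /-- the degree of a closed point -/
  deg : Point → ℕ
  deg_pos : ∀ P, 0 < deg P
  /-- the genus of the curve -/
  genus : ℕ
  /-- the normalized discrete valuation at a closed point -/
  v : Point → K → ℤ
  v_zero : ∀ P, v P 0 = 0
  v_mul : ∀ (P : Point) {x y : K}, x ≠ 0 → y ≠ 0 → v P (x * y) = v P x + v P y
  v_min_le_add : ∀ (P : Point) {x y : K}, x ≠ 0 → y ≠ 0 → x + y ≠ 0 →
    min (v P x) (v P y) ≤ v P (x + y)
  v_algebraMap : ∀ (P : Point) (c : Fq), c ≠ 0 → v P (algebraMap Fq K c) = 0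
  v_surjective : ∀ P : Point, ∃ x : K, x ≠ 0 ∧ v P x = 1
  /-- a nonzero function has only finitely many zeros and poles -/
  support_finite : ∀ {x : K}, x ≠ 0 → {P : Point | v P x ≠ 0}.Finite
  /-- a function without poles is constant (the curve is projective and
  geometrically irreducible) -/
  no_pole_constant : ∀ {x : K}, x ≠ 0 → (∀ P, 0 ≤ v P x) → ∃ c : Fq, x = algebraMap Fq K c
  /-- principal divisors have degree zero -/
  degree_principal : ∀ {x : K}, x ≠ 0 → ∑ᶠ P : Point, (deg P : ℤ) * v P x = 0

attribute [instance] Curve.fieldK Curve.algebraK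

namespace Curve

variable {Fq : Type} [Field Fq] [Fintype Fq]

/-- The degree of a divisor. -/
noncomputable def degDiv (C : Curve Fq) (D : C.Point →₀ ℤ) : ℤ :=
  D.sum fun P n => (C.deg P : ℤ) * n

/-- The Riemann–Roch space `L(D)`. -/
def Lset (C : Curve Fq) (D : C.Point →₀ ℤ) : Set C.K :=
  {h | h = 0 ∨ ∀ P : C.Point, 0 ≤ C.v P h + D P}

/-- `ℓ(D)`, the dimension of `L(D)` as an `Fq`-vector space. -/
noncomputable def ell (C : Curve Fq) (D : C.Point →₀ ℤ) : ℕ :=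
  Module.finrank Fq (Submodule.span Fq (C.Lset D))

/-- The divisor `D` is principal. -/
def IsPrincipalDiv (C : Curve Fq) (D : C.Point →₀ ℤ) : Prop :=
  ∃ h : C.K, h ≠ 0 ∧ ∀ P : C.Point, C.v P h = D P

/-- The divisor `D_α = α₁Q₁ + ⋯ + α_mQ_m`. -/
noncomputable def Dt (C : Curve Fq) {m : ℕ} (Q : Fin m → C.Point) (α : Fin m → ℤ) :
    C.Point →₀ ℤ :=
  ∑ i, Finsupp.single (Q i) (α i)

/-- The generalized Weierstrass semigroup `Ĥ(Q)`: the set of tuples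
`(-v_{Q_1}(h), …, -v_{Q_m}(h))` for nonzero `h` having poles only in `{Q_1, …, Q_m}`. -/
def Hhat (C : Curve Fq) {m : ℕ} (Q : Fin m → C.Point) : Set (Fin m → ℤ) :=
  {α | ∃ h : C.K, h ≠ 0 ∧ (∀ P : C.Point, P ∉ Set.range Q → 0 ≤ C.v P h) ∧
    ∀ i, α i = -C.v (Q i) h}

/-- `∇_J(α)`. -/
def nabla (C : Curve Fq) {m : ℕ} (Q : Fin m → C.Point) (J : Set (Fin m))
    (α : Fin m → ℤ) : Set (Fin m → ℤ) :=
  {β | β ∈ C.Hhat Q ∧ (∀ j ∈ J, β j = α j) ∧ ∀ i ∉ J, β i < α i}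

/-- `∇_i^m(α)`. -/
def nablaI (C : Curve Fq) {m : ℕ} (Q : Fin m → C.Point) (i : Fin m) (α : Fin m → ℤ) :
    Set (Fin m → ℤ) :=
  {β | β ∈ C.Hhat Q ∧ β i = α i ∧ ∀ j, j ≠ i → β j ≤ α j}

/-- `Γ̂(Q)`, the set of absolute maximal elements of `Ĥ(Q)`. -/
def Gammahat (C : Curve Fq) {m : ℕ} (Q : Fin m → C.Point) : Set (Fin m → ℤ) :=
  {α | α ∈ C.Hhat Q ∧
    ∀ J : Set (Fin m), J.Nonempty → J ≠ Set.univ → C.nabla Q J α = ∅}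

/-- `Γ̂_Q(α) = {β ∈ Γ̂(Q) : β ≤ α}`. -/
def GammahatLe (C : Curve Fq) {m : ℕ} (Q : Fin m → C.Point) (α : Fin m → ℤ) :
    Set (Fin m → ℤ) :=
  {β | β ∈ C.Gammahat Q ∧ ∀ i, β i ≤ α i}

/-- The divisor `A` is a discrepancy with respect to `P` and `Q'`. -/
def IsDiscrepancy (C : Curve Fq) (A : C.Point →₀ ℤ) (P Q' : C.Point) : Prop :=
  C.Lset A ≠ C.Lset (A - Finsupp.single Q' 1) ∧
  C.Lset (A - Finsupp.single P 1) = C.Lset (A - Finsupp.single P 1 - Finsupp.single Q' 1)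

/-- `T_α = {β ∈ ℤ^m : β ≤ α and ℓ(D_β) = ℓ(D_α)}`. -/
def Tset (C : Curve Fq) {m : ℕ} (Q : Fin m → C.Point) (α : Fin m → ℤ) :
    Set (Fin m → ℤ) :=
  {β | (∀ j, β j ≤ α j) ∧ C.ell (C.Dt Q β) = C.ell (C.Dt Q α)}

/-- `D_β` is the supported floor `⌊D_α⌋_Q`: `β` is the element of `T_α` of minimum
norm `|β| = β₁ + ⋯ + β_m`. -/
def IsSuppFloor (C : Curve Fq) {m : ℕ} (Q : Fin m → C.Point) (α β : Fin m → ℤ) : Prop :=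
  β ∈ C.Tset Q α ∧ ∀ γ ∈ C.Tset Q α, ∑ i, β i ≤ ∑ i, γ i

/-- `G'` is the floor `⌊G⌋` of `G`: among all divisors with the same Riemann–Roch
space as `G`, it has minimum degree. -/
def IsFloorDiv (C : Curve Fq) (G G' : C.Point →₀ ℤ) : Prop :=
  C.Lset G' = C.Lset G ∧
  ∀ G'' : C.Point →₀ ℤ, C.Lset G'' = C.Lset G → C.degDiv G' ≤ C.degDiv G''

end Curve

namespace Curve

section Valuation

variable {Fq : Type} [Field Fq] (C : Curve Fq)

/-- The functions vanishing to order at least `n` at `P`. -/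
def orderGE (P : C.Point) (n : ℤ) : Submodule Fq C.K where
  carrier := {x | x = 0 ∨ n ≤ C.v P x}
  zero_mem' := Or.inl rfl
  add_mem' := by
    rintro x y (rfl | hx) (rfl | hy)
    · simp
    · simpa using Or.inr hy
    · simpa using Or.inr hx
    · by_cases hx0 : x = 0
      · simpa [hx0] using Or.inr hy
      by_cases hy0 : y = 0
      · simpa [hy0] using Or.inr hx
      by_cases h : x + y = 0
      · exact Or.inl h
      · exact Or.inr ((le_min hx hy).trans (C.v_min_le_add P hx0 hy0 h))
  smul_mem' := by
    rintro c x (rfl | hx)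
    · simp
    by_cases hc : c = 0
    · simp [hc]
    by_cases hx0 : x = 0
    · simp [hx0]
    refine Or.inr ?_
    have hc' : algebraMap Fq C.K c ≠ 0 := by simpa using hc
    rw [Algebra.smul_def, C.v_mul P hc' hx0, C.v_algebraMap P c hc, zero_add]
    exact hx

lemma mem_orderGE {P : C.Point} {n : ℤ} {x : C.K} :
    x ∈ C.orderGE P n ↔ x = 0 ∨ n ≤ C.v P x := Iff.rfl

lemma mem_orderGE_of_ne_zero {P : C.Point} {n : ℤ} {x : C.K} (hx : x ≠ 0) :
    x ∈ C.orderGE P n ↔ n ≤ C.v P x := by simp [mem_orderGE, hx]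

/-- The Riemann–Roch space `L(D)` as a subspace of the function field. -/
def riemannRochSpace (D : C.Point →₀ ℤ) : Submodule Fq C.K := ⨅ P, C.orderGE P (-D P)

lemma mem_riemannRochSpace {D : C.Point →₀ ℤ} {x : C.K} (hx : x ≠ 0) :
    x ∈ C.riemannRochSpace D ↔ ∀ P, -D P ≤ C.v P x := by
  simp [riemannRochSpace, mem_orderGE, hx]

lemma coe_riemannRochSpace (D : C.Point →₀ ℤ) :
    (C.riemannRochSpace D : Set C.K) = C.Lset D := by
  ext x
  by_cases hx : x = 0
  · simp [hx, Lset]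
  · rw [SetLike.mem_coe, C.mem_riemannRochSpace hx]
    simp only [Lset, Set.mem_ofPred_eq, hx, false_or]
    exact forall_congr' fun P => ⟨fun h => by linarith, fun h => by linarith⟩

lemma ell_eq_finrank (D : C.Point →₀ ℤ) :
    C.ell D = Module.finrank Fq (C.riemannRochSpace D) := by
  rw [ell, ← coe_riemannRochSpace, Submodule.span_eq]

lemma riemannRochSpace_mono {D E : C.Point →₀ ℤ} (h : D ≤ E) :
    C.riemannRochSpace D ≤ C.riemannRochSpace E := by
  intro x hx
  by_cases hx0 : x = 0
  · simp [hx0]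
  rw [mem_riemannRochSpace _ hx0] at hx ⊢
  exact fun P => (neg_le_neg (h P)).trans (hx P)

lemma degDiv_add (D E : C.Point →₀ ℤ) : C.degDiv (D + E) = C.degDiv D + C.degDiv E :=
  Finsupp.sum_add_index' (by simp) (by intros; ring)

lemma degDiv_single (P : C.Point) (n : ℤ) :
    C.degDiv (Finsupp.single P n) = C.deg P * n :=
  Finsupp.sum_single_index (by simp)

lemma degDiv_nonneg {D : C.Point →₀ ℤ} (h : ∀ P, 0 ≤ D P) : 0 ≤ C.degDiv D :=
  Finset.sum_nonneg fun P _ => mul_nonneg (by positivity) (h P)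

/-- The divisor of a nonzero function. -/
noncomputable def principalDiv {x : C.K} (hx : x ≠ 0) : C.Point →₀ ℤ :=
  Finsupp.ofSupportFinite (fun P => C.v P x) (C.support_finite hx)

@[simp] lemma principalDiv_apply {x : C.K} (hx : x ≠ 0) (P : C.Point) :
    C.principalDiv hx P = C.v P x := rfl

lemma degDiv_principalDiv {x : C.K} (hx : x ≠ 0) : C.degDiv (C.principalDiv hx) = 0 := by
  rw [← C.degree_principal hx, degDiv, Finsupp.sum]
  refine (finsum_eq_sum_of_support_subset _ fun P hP => ?_).symm
  have : C.v P x ≠ 0 := right_ne_zero_of_mul (Function.mem_support.1 hP)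
  simpa using this

lemma degDiv_nonneg_of_mem {D : C.Point →₀ ℤ} {x : C.K} (hx : x ≠ 0)
    (h : x ∈ C.riemannRochSpace D) : 0 ≤ C.degDiv D := by
  rw [mem_riemannRochSpace _ hx] at h
  have := C.degDiv_nonneg (D := C.principalDiv hx + D) fun P => by
    have := h P
    simp only [Finsupp.add_apply, principalDiv_apply]
    linarith
  rwa [degDiv_add, degDiv_principalDiv, zero_add] at this

lemma riemannRochSpace_eq_bot {D : C.Point →₀ ℤ} (h : C.degDiv D < 0) :
    C.riemannRochSpace D = ⊥ := by
  rw [Submodule.eq_bot_iff]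
  intro x hx
  by_contra hx0
  exact absurd (C.degDiv_nonneg_of_mem hx0 hx) (not_le.2 h)

end Valuation

section RiemannRoch

variable {Fq : Type} [Field Fq] {C : Curve Fq} {K₀ : C.Point →₀ ℤ}

lemma finrank_riemannRochSpace_of_degDiv_lt
    (hRR : ∀ D : C.Point →₀ ℤ,
      (C.ell D : ℤ) - C.ell (K₀ - D) = C.degDiv D + 1 - C.genus)
    {D : C.Point →₀ ℤ} (hD : C.degDiv K₀ < C.degDiv D) :
    (Module.finrank Fq (C.riemannRochSpace D) : ℤ) = C.degDiv D + 1 - C.genus := by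
  have hdeg : C.degDiv (K₀ - D) < 0 := by
    have := C.degDiv_add (K₀ - D) D
    rw [sub_add_cancel] at this
    linarith
  have := hRR D
  rwa [C.ell_eq_finrank (K₀ - D), C.riemannRochSpace_eq_bot hdeg, finrank_bot, C.ell_eq_finrank,
    Nat.cast_zero, sub_zero] at this

lemma exists_degDiv_add_single_gt (D : C.Point →₀ ℤ) (P : C.Point) (N : ℤ) :
    ∃ k : ℤ, 0 ≤ k ∧ N < C.degDiv (D + Finsupp.single P k) := by
  refine ⟨|N| + |C.degDiv D| + 1, by positivity, ?_⟩
  rw [degDiv_add, degDiv_single]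
  have hP : (1 : ℤ) ≤ C.deg P := by exact_mod_cast C.deg_pos P
  have h1 := le_abs_self N
  have h2 := neg_abs_le (C.degDiv D)
  nlinarith [abs_nonneg N, abs_nonneg (C.degDiv D)]

lemma finite_riemannRochSpace
    (hRR : ∀ D : C.Point →₀ ℤ,
      (C.ell D : ℤ) - C.ell (K₀ - D) = C.degDiv D + 1 - C.genus)
    (P : C.Point) (D : C.Point →₀ ℤ) : Module.Finite Fq (C.riemannRochSpace D) := by
  obtain ⟨k, hk, hdeg⟩ := exists_degDiv_add_single_gt D P (max (C.degDiv K₀) C.genus)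
  have hr := finrank_riemannRochSpace_of_degDiv_lt hRR ((le_max_left _ _).trans_lt hdeg)
  have hg := (le_max_right _ _).trans_lt hdeg
  have : Module.Finite Fq (C.riemannRochSpace (D + Finsupp.single P k)) :=
    Module.finite_of_finrank_pos (by omega)
  exact Submodule.finiteDimensional_of_le
    (C.riemannRochSpace_mono (E := D + Finsupp.single P k)
      (le_add_of_nonneg_right (Finsupp.single_nonneg.2 hk)))

/-- At a rational point, functions of equal order have proportional leading coefficients. -/
lemma exists_sub_smul_mem_orderGE
    (hRR : ∀ D : C.Point →₀ ℤ,
      (C.ell D : ℤ) - C.ell (K₀ - D) = C.degDiv D + 1 - C.genus)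
    {P R : C.Point} (hPR : R ≠ P) (hP : C.deg P = 1) {x y : C.K} (hx : x ≠ 0) (hy : y ≠ 0)
    (hxy : C.v P x = C.v P y) : ∃ c : Fq, x - c • y ∈ C.orderGE P (C.v P x + 1) := by
  set E : C.Point →₀ ℤ := (-C.principalDiv hx) ⊔ (-C.principalDiv hy) with hE
  have hE_apply (S : C.Point) : E S = max (-C.v S x) (-C.v S y) := by
    simp [hE, Finsupp.sup_apply]
  obtain ⟨k, hk, hdeg⟩ := exists_degDiv_add_single_gt E R (C.degDiv K₀ + 1)
  set D := E + Finsupp.single R k with hD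
  have hED (S : C.Point) : E S ≤ D S := by
    have : (0 : C.Point →₀ ℤ) S ≤ Finsupp.single R k S := Finsupp.single_nonneg.2 hk S
    simpa [hD] using this
  have hDP : D P = -C.v P x := by simp [hD, hE_apply, hxy, hPR]
  set D' := D - Finsupp.single P 1 with hD'
  have hdeg' : C.degDiv D = C.degDiv D' + 1 := by
    conv_lhs => rw [← sub_add_cancel D (Finsupp.single P 1)]
    rw [degDiv_add, degDiv_single, hP, hD']
    simp
  have hr := finrank_riemannRochSpace_of_degDiv_lt hRR (D := D) (by linarith)
  have hr' := finrank_riemannRochSpace_of_degDiv_lt hRR (D := D') (by linarith)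
  have := finite_riemannRochSpace hRR P D
  have hxD : x ∈ C.riemannRochSpace D := by
    rw [mem_riemannRochSpace _ hx]
    intro S
    linarith [hED S, hE_apply S, le_max_left (-C.v S x) (-C.v S y)]
  have hyD : y ∈ C.riemannRochSpace D := by
    rw [mem_riemannRochSpace _ hy]
    intro S
    linarith [hED S, hE_apply S, le_max_right (-C.v S x) (-C.v S y)]
  have hD'P : -D' P = C.v P x + 1 := by simp [hD', hDP, add_comm]
  have hyD' : y ∉ C.riemannRochSpace D' := by
    rw [mem_riemannRochSpace _ hy]
    intro h
    linarith [h P]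
  have hle : C.riemannRochSpace D' ≤ C.riemannRochSpace D :=
    C.riemannRochSpace_mono (by simp [hD'])
  have hsup : C.riemannRochSpace D' ⊔ Submodule.span Fq {y} = C.riemannRochSpace D := by
    have hsup_le : C.riemannRochSpace D' ⊔ Submodule.span Fq {y} ≤ C.riemannRochSpace D :=
      sup_le hle (by simpa using hyD)
    refine Submodule.eq_of_le_of_finrank_le hsup_le ?_
    have := Submodule.finiteDimensional_of_le hsup_le
    have hlt : C.riemannRochSpace D' < C.riemannRochSpace D' ⊔ Submodule.span Fq {y} :=
      lt_of_le_of_ne le_sup_left fun h => hyD' (by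
        rw [h]
        exact Submodule.mem_sup_right (Submodule.mem_span_singleton_self y))
    have := Submodule.finrank_lt_finrank_of_lt hlt
    omega
  rw [← hsup, Submodule.mem_sup] at hxD
  obtain ⟨z, hz, w, hw, rfl⟩ := hxD
  obtain ⟨c, rfl⟩ := Submodule.mem_span_singleton.1 hw
  refine ⟨c, ?_⟩
  rw [add_sub_cancel_right, ← hD'P]
  exact (Submodule.mem_iInf _).1 hz P

/-- The dimension of a space of functions of bounded order at a rational point is the number of
orders its nonzero elements take there. -/
lemma encard_image_v_eq_finrank {P : C.Point}
    (hlead : ∀ {x y : C.K}, x ≠ 0 → y ≠ 0 → C.v P x = C.v P y →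
      ∃ c : Fq, x - c • y ∈ C.orderGE P (C.v P x + 1))
    {B : ℤ} {d : ℕ} {V : Submodule Fq C.K} [Module.Finite Fq V]
    (hB : V ≤ C.orderGE P B) (hd : Module.finrank Fq V = d) :
    (C.v P '' {x | x ∈ V ∧ x ≠ 0}).encard = d := by
  induction d generalizing V with
  | zero =>
    rw [Submodule.finrank_eq_zero] at hd
    simp [hd]
  | succ d ih =>
    have hV : V ≠ ⊥ := by
      rintro rfl
      simp at hd
    obtain ⟨x₀, hx₀, hx₀0⟩ := V.ne_bot_iff.1 hV
    obtain ⟨N, ⟨y, hyV, hy0, hyN⟩, hN⟩ := Int.exists_least_of_bdd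
      (P := fun n => ∃ x ∈ V, x ≠ 0 ∧ C.v P x = n)
      ⟨B, by
        rintro _ ⟨x, hx, hx0, rfl⟩
        exact (C.mem_orderGE_of_ne_zero hx0).1 (hB hx)⟩ ⟨_, x₀, hx₀, hx₀0, rfl⟩
    set W := V ⊓ C.orderGE P (N + 1) with hW
    have hWV : W ≤ V := inf_le_left
    have : Module.Finite Fq W := Submodule.finiteDimensional_of_le hWV
    have hyW : y ∉ W := fun h => by
      have := (C.mem_orderGE_of_ne_zero hy0).1 h.2
      omega
    have hsup : W ⊔ Submodule.span Fq {y} = V := by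
      refine le_antisymm (sup_le hWV (by simpa using hyV)) fun x hx => ?_
      by_cases hx0 : x = 0
      · simp [hx0]
      rcases (hN _ ⟨x, hx, hx0, rfl⟩).lt_or_eq with h | h
      · exact Submodule.mem_sup_left ⟨hx, Or.inr h⟩
      · obtain ⟨c, hc⟩ := hlead hx0 hy0 (h.symm.trans hyN.symm)
        rw [← sub_add_cancel x (c • y)]
        refine Submodule.add_mem_sup ⟨V.sub_mem hx (V.smul_mem c hyV), ?_⟩
          (Submodule.smul_mem _ c (Submodule.mem_span_singleton_self y))
        rwa [h]
    have hdisj : Disjoint W (Submodule.span Fq {y}) :=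
      (Submodule.disjoint_span_singleton' hy0).2 hyW
    have hrank : Module.finrank Fq W = d := by
      have := Submodule.finrank_sup_add_finrank_inf_eq W (Submodule.span Fq {y})
      rw [hsup, hdisj.eq_bot, finrank_bot, finrank_span_singleton hy0] at this
      omega
    have himage : C.v P '' {x | x ∈ V ∧ x ≠ 0} =
        insert N (C.v P '' {x | x ∈ W ∧ x ≠ 0}) := by
      ext n
      constructor
      · rintro ⟨x, ⟨hx, hx0⟩, rfl⟩
        rcases (hN _ ⟨x, hx, hx0, rfl⟩).lt_or_eq with h | h
        · exact Or.inr ⟨x, ⟨⟨hx, Or.inr h⟩, hx0⟩, rfl⟩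
        · exact Or.inl h.symm
      · rintro (rfl | ⟨x, ⟨hx, hx0⟩, rfl⟩)
        · exact ⟨y, ⟨hyV, hy0⟩, hyN⟩
        · exact ⟨x, ⟨hWV hx, hx0⟩, rfl⟩
    have hnot : N ∉ C.v P '' {x | x ∈ W ∧ x ≠ 0} := by
      rintro ⟨x, ⟨hx, hx0⟩, h⟩
      have := (C.mem_orderGE_of_ne_zero hx0).1 hx.2
      omega
    rw [himage, Set.encard_insert_of_notMem hnot, ih (hWV.trans hB) hrank]
    simp

end RiemannRoch

section Weierstrass

variable {Fq : Type} [Field Fq] (C : Curve Fq) {m : ℕ} {Q : Fin m → C.Point}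

lemma Dt_apply (hQ : Function.Injective Q) (α : Fin m → ℤ) (i : Fin m) :
    C.Dt Q α (Q i) = α i := by
  simp [Dt, Finsupp.finsetSum_apply, Finsupp.single_apply, hQ.eq_iff]

lemma Dt_apply_of_notMem (α : Fin m → ℤ) {P : C.Point} (hP : P ∉ Set.range Q) :
    C.Dt Q α P = 0 := by
  rw [Dt, Finsupp.finsetSum_apply]
  exact Finset.sum_eq_zero fun i _ => Finsupp.single_eq_of_ne fun h => hP ⟨i, h.symm⟩

lemma degDiv_Dt (hQdeg : ∀ i, C.deg (Q i) = 1) (α : Fin m → ℤ) :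
    C.degDiv (C.Dt Q α) = ∑ i, α i := by
  have (s : Finset (Fin m)) :
      C.degDiv (∑ i ∈ s, Finsupp.single (Q i) (α i)) = ∑ i ∈ s, α i := by
    induction s using Finset.induction_on with
    | empty => simp [degDiv]
    | insert i s hi ih =>
      rw [Finset.sum_insert hi, Finset.sum_insert hi, degDiv_add, degDiv_single, ih, hQdeg]
      simp
  exact this _

lemma mem_riemannRochSpace_Dt (hQ : Function.Injective Q) {α : Fin m → ℤ} {x : C.K}
    (hx : x ≠ 0) : x ∈ C.riemannRochSpace (C.Dt Q α) ↔
      (∀ P ∉ Set.range Q, 0 ≤ C.v P x) ∧ ∀ i, -C.v (Q i) x ≤ α i := by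
  rw [mem_riemannRochSpace _ hx]
  constructor
  · intro h
    refine ⟨fun P hP => ?_, fun i => ?_⟩
    · simpa [C.Dt_apply_of_notMem α hP] using h P
    · have := h (Q i)
      rw [C.Dt_apply hQ] at this
      linarith
  · rintro ⟨h₁, h₂⟩ P
    by_cases hP : P ∈ Set.range Q
    · obtain ⟨i, rfl⟩ := hP
      rw [C.Dt_apply hQ]
      linarith [h₂ i]
    · simpa [C.Dt_apply_of_notMem α hP] using h₁ P hP

lemma sum_nonneg_of_mem_Hhat (hQ : Function.Injective Q) (hQdeg : ∀ i, C.deg (Q i) = 1)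
    {β : Fin m → ℤ} (hβ : β ∈ C.Hhat Q) : 0 ≤ ∑ i, β i := by
  obtain ⟨h, h0, hreg, hv⟩ := hβ
  rw [← C.degDiv_Dt hQdeg]
  exact C.degDiv_nonneg_of_mem h0
    ((C.mem_riemannRochSpace_Dt hQ h0).2 ⟨hreg, fun i => (hv i).ge⟩)

/-- If `∇_J(β)` is nonempty and `i ∉ J`, then `β` can be strictly lowered inside `Ĥ(Q)` without
changing its `i`-th coordinate. -/
lemma exists_mem_Hhat_lt_of_mem_nabla (hQ : Function.Injective Q)
    (hlead : ∀ j, ∀ {x y : C.K}, x ≠ 0 → y ≠ 0 → C.v (Q j) x = C.v (Q j) y →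
      ∃ c : Fq, x - c • y ∈ C.orderGE (Q j) (C.v (Q j) x + 1))
    {β γ : Fin m → ℤ} (hβ : β ∈ C.Hhat Q) {J : Set (Fin m)} {i j : Fin m} (hj : j ∈ J)
    (hi : i ∉ J) (hγ : γ ∈ C.nabla Q J β) :
    ∃ δ ∈ C.Hhat Q, (∀ k, δ k ≤ β k) ∧ δ i = β i ∧ δ j < β j := by
  obtain ⟨⟨y, hy0, hyreg, hyv⟩, hγJ, hγJ'⟩ := hγ
  obtain ⟨x, hx0, hxreg, hxv⟩ := hβ
  have hγβ (k : Fin m) : γ k ≤ β k := by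
    by_cases hk : k ∈ J
    · exact (hγJ k hk).le
    · exact (hγJ' k hk).le
  have hvj : C.v (Q j) x = C.v (Q j) y := by
    have := hγJ j hj
    rw [hyv, hxv] at this
    exact (neg_injective this).symm
  obtain ⟨c, hc⟩ := hlead j hx0 hy0 hvj
  have hxi := hxv i
  have hyi := hyv i
  have hγi := hγJ' i hi
  have hcy : c • y ∈ C.orderGE (Q i) (C.v (Q i) x + 1) :=
    Submodule.smul_mem _ c (Or.inr (by omega))
  have hnot : x - c • y ∉ C.orderGE (Q i) (C.v (Q i) x + 1) := fun h => by
    have := (C.mem_orderGE_of_ne_zero hx0).1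
      ((Submodule.sub_mem_iff_left _ hcy).1 h)
    omega
  have h0 : x - c • y ≠ 0 := fun h => hnot (h ▸ Submodule.zero_mem _)
  have hmem : x - c • y ∈ C.riemannRochSpace (C.Dt Q β) := by
    refine Submodule.sub_mem _ ?_ (Submodule.smul_mem _ c ?_)
    · exact (C.mem_riemannRochSpace_Dt hQ hx0).2 ⟨hxreg, fun k => (hxv k).ge⟩
    · exact (C.mem_riemannRochSpace_Dt hQ hy0).2 ⟨hyreg, fun k => (hyv k).symm.trans_le (hγβ k)⟩
  rw [C.mem_riemannRochSpace_Dt hQ h0] at hmem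
  refine ⟨fun k => -C.v (Q k) (x - c • y), ⟨_, h0, hmem.1, fun _ => rfl⟩, hmem.2, ?_, ?_⟩
  · rw [C.mem_orderGE_of_ne_zero h0] at hnot
    have := hmem.2 i
    dsimp only
    omega
  · rw [C.mem_orderGE_of_ne_zero h0] at hc
    have := hxv j
    dsimp only
    omega

/-- Every element of `Ĥ(Q)` dominates an absolute maximal element with the same `i`-th
coordinate. -/
lemma exists_mem_Gammahat_le (hQ : Function.Injective Q) (hQdeg : ∀ i, C.deg (Q i) = 1)
    (hlead : ∀ j, ∀ {x y : C.K}, x ≠ 0 → y ≠ 0 → C.v (Q j) x = C.v (Q j) y →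
      ∃ c : Fq, x - c • y ∈ C.orderGE (Q j) (C.v (Q j) x + 1))
    {β : Fin m → ℤ} (hβ : β ∈ C.Hhat Q) (i : Fin m) :
    ∃ γ ∈ C.Gammahat Q, (∀ k, γ k ≤ β k) ∧ γ i = β i := by
  obtain ⟨N, ⟨γ, hγ, hγβ, hγi, hγN⟩, hN⟩ := Int.exists_least_of_bdd
    (P := fun n => ∃ γ ∈ C.Hhat Q, (∀ k, γ k ≤ β k) ∧ γ i = β i ∧ ∑ k, γ k = n)
    ⟨0, by
      rintro _ ⟨γ, hγ, -, -, rfl⟩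
      exact C.sum_nonneg_of_mem_Hhat hQ hQdeg hγ⟩ ⟨_, β, hβ, fun _ => le_rfl, rfl, rfl⟩
  have hmin {δ : Fin m → ℤ} (hδ : δ ∈ C.Hhat Q) (hle : ∀ k, δ k ≤ γ k) (hδi : δ i = γ i)
      (k : Fin m) : ¬ δ k < γ k := fun hk => by
    have h₁ := hN _ ⟨δ, hδ, fun l => (hle l).trans (hγβ l), hδi.trans hγi, rfl⟩
    have h₂ : ∑ l, δ l < ∑ l, γ l :=
      Finset.sum_lt_sum (fun l _ => hle l) ⟨k, Finset.mem_univ k, hk⟩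
    omega
  refine ⟨γ, ⟨hγ, fun J ⟨j, hj⟩ hJ => Set.eq_empty_of_forall_notMem fun δ hδ => ?_⟩, hγβ, hγi⟩
  by_cases hi : i ∈ J
  · obtain ⟨k, hk⟩ := (Set.ne_univ_iff_exists_notMem J).1 hJ
    refine hmin hδ.1 (fun l => ?_) (hδ.2.1 i hi) k (hδ.2.2 k hk)
    by_cases hl : l ∈ J
    · exact (hδ.2.1 l hl).le
    · exact (hδ.2.2 l hl).le
  · obtain ⟨ε, hε, hle, hεi, hlt⟩ := C.exists_mem_Hhat_lt_of_mem_nabla hQ hlead hγ hj hi hδ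
    exact hmin hε hle hεi j hlt

lemma image_GammahatLe (hQ : Function.Injective Q) (hQdeg : ∀ i, C.deg (Q i) = 1)
    (hlead : ∀ j, ∀ {x y : C.K}, x ≠ 0 → y ≠ 0 → C.v (Q j) x = C.v (Q j) y →
      ∃ c : Fq, x - c • y ∈ C.orderGE (Q j) (C.v (Q j) x + 1))
    (α : Fin m → ℤ) (i : Fin m) :
    (fun β : Fin m → ℤ => β i) '' C.GammahatLe Q α =
      Neg.neg '' (C.v (Q i) '' {x | x ∈ C.riemannRochSpace (C.Dt Q α) ∧ x ≠ 0}) := by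
  rw [Set.image_image]
  ext n
  constructor
  · rintro ⟨β, ⟨⟨⟨x, hx0, hreg, hv⟩, -⟩, hβα⟩, rfl⟩
    exact ⟨x, ⟨(C.mem_riemannRochSpace_Dt hQ hx0).2
      ⟨hreg, fun k => (hv k).symm.trans_le (hβα k)⟩, hx0⟩, (hv i).symm⟩
  · rintro ⟨x, ⟨hx, hx0⟩, rfl⟩
    rw [C.mem_riemannRochSpace_Dt hQ hx0] at hx
    obtain ⟨γ, hγ, hle, hγi⟩ := C.exists_mem_Gammahat_le hQ hQdeg hlead
      (β := fun k => -C.v (Q k) x) ⟨x, hx0, hx.1, fun _ => rfl⟩ i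
    exact ⟨γ, ⟨hγ, fun k => (hle k).trans (hx.2 k)⟩, hγi⟩

end Weierstrass

end Curve

/-- Theorem 2.5: assume `q ≥ m`.  For any `α ∈ ℤ^m` and any
`i ∈ {1, …, m}`, `ℓ(D_α)` equals the number of equivalence classes of `Γ̂_Q(α)`
under `β ≡_i β' ↔ β_i = β'_i`, i.e. the number of values of the `i`-th coordinate
on `Γ̂_Q(α)`. -/
theorem statement19 {Fq : Type} [Field Fq] [Fintype Fq] (C : Curve Fq)
    (hgenus : 0 < C.genus) (K₀ : C.Point →₀ ℤ)
    (hRR : ∀ D : C.Point →₀ ℤ,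
      (C.ell D : ℤ) - C.ell (K₀ - D) = C.degDiv D + 1 - C.genus)
    {m : ℕ} (hm : 2 ≤ m) (Q : Fin m → C.Point)
    (hQinj : Function.Injective Q) (hQdeg : ∀ i, C.deg (Q i) = 1)
    (hq : m ≤ Fintype.card Fq) (α : Fin m → ℤ) (i : Fin m) :
    C.ell (C.Dt Q α) = ((fun β : Fin m → ℤ => β i) '' C.GammahatLe Q α).ncard := by
  have hlead (j : Fin m) {x y : C.K} (hx : x ≠ 0) (hy : y ≠ 0) (hxy : C.v (Q j) x = C.v (Q j) y) :
      ∃ c : Fq, x - c • y ∈ C.orderGE (Q j) (C.v (Q j) x + 1) := by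
    have : Nontrivial (Fin m) := Fin.nontrivial_iff_two_le.2 hm
    obtain ⟨k, hk⟩ := exists_ne j
    exact Curve.exists_sub_smul_mem_orderGE hRR (hQinj.ne hk) (hQdeg j) hx hy hxy
  have := Curve.finite_riemannRochSpace hRR (Q i) (C.Dt Q α)
  have hcard := Curve.encard_image_v_eq_finrank (V := C.riemannRochSpace (C.Dt Q α)) (hlead i)
    (iInf_le (fun P => C.orderGE P (-C.Dt Q α P)) (Q i)) rfl
  rw [C.image_GammahatLe hQinj hQdeg hlead, Set.ncard_image_of_injective _ neg_injective,
    Set.ncard_def, hcard, ENat.toNat_natCast, C.ell_eq_finrank]
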